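/- arXiv:2310.18125 — 3 statements merged into one kernel-verified Lean document; each statement's English description precedes it below -/
import Mathlib

section
/- Let A and B be separable C*-algebras and let φ: A → B be an injective *-homomorphism. Then φ is approximately unitarily equivalent to a *-isomorphism from A onto B if and only if: for every ε > 0 and all finite sets F ⊆ A and G ⊆ B, there exists a unitary z ∈ U(M(B)) such that ‖z φ(a) z* − φ(a)‖ ≤ ε for all a ∈ F, and dist(z* b z, φ(A)) ≤ ε for all b ∈ G. -/
open Filter Topology MultiplierAlgebra

/-- Two maps `A → B` are approximately unitarily equivalent if there is a sequence of
unitaries in the multiplier algebra `𝓜(ℂ, B)` conjugating one to the other pointwise in norm. -/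
def ApproxUnitaryEquiv {A B : Type*} [NonUnitalCStarAlgebra A] [NonUnitalCStarAlgebra B]
    (φ ψ : A → B) : Prop :=
  ∃ u : ℕ → unitary 𝓜(ℂ, B), ∀ a : A,
    Tendsto
      (fun n => ‖(u n : 𝓜(ℂ, B)) * (φ a : 𝓜(ℂ, B)) * star (u n : 𝓜(ℂ, B)) - (ψ a : 𝓜(ℂ, B))‖)
      atTop (𝓝 (0 : ℝ))

namespace DoubleCentralizer

variable {B : Type*} [NonUnitalCStarAlgebra B]

theorem fst_mul_apply (m : 𝓜(ℂ, B)) (x y : B) : m.fst (x * y) = m.fst x * y := by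
  have h (c : B) : c * m.fst (x * y) = c * (m.fst x * y) := by
    rw [← m.central, ← mul_assoc, ← mul_assoc, m.central]
  rw [← sub_eq_zero, ← CStarRing.star_mul_self_eq_zero_iff, mul_sub, h, sub_self]

theorem snd_mul_apply (m : 𝓜(ℂ, B)) (x y : B) : m.snd (x * y) = x * m.snd y := by
  have h (c : B) : m.snd (x * y) * c = x * m.snd y * c := by
    rw [m.central, mul_assoc, mul_assoc, m.central]
  rw [← sub_eq_zero, ← CStarRing.mul_star_self_eq_zero_iff, sub_mul, h, sub_self]

theorem coe_fst_apply (m : 𝓜(ℂ, B)) (b : B) : ((m.fst b : B) : 𝓜(ℂ, B)) = m * b := by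
  ext c
  · simp [fst_mul_apply]
  · simp [m.central]

theorem coe_snd_apply (m : 𝓜(ℂ, B)) (b : B) : ((m.snd b : B) : 𝓜(ℂ, B)) = b * m := by
  ext c
  · simp [m.central]
  · simp [snd_mul_apply]

theorem coeHom_injective : Function.Injective (coeHom : B →⋆ₙₐ[ℂ] 𝓜(ℂ, B)) := by
  rw [injective_iff_map_eq_zero]
  intro b hb
  have h := congrArg (fun m : 𝓜(ℂ, B) => m.fst (star b)) hb
  simpa using h

theorem isometry_coeHom : Isometry (coeHom : B →⋆ₙₐ[ℂ] 𝓜(ℂ, B)) :=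
  NonUnitalStarAlgHom.isometry _ coeHom_injective

/-- Conjugation of `B` by a unitary multiplier. -/
noncomputable def conjApply (u : unitary 𝓜(ℂ, B)) (b : B) : B :=
  (u : 𝓜(ℂ, B)).fst ((star (u : 𝓜(ℂ, B))).snd b)

theorem coeHom_conjApply (u : unitary 𝓜(ℂ, B)) (b : B) :
    coeHom (𝕜 := ℂ) (conjApply u b) = (u : 𝓜(ℂ, B)) * coeHom b * star (u : 𝓜(ℂ, B)) := by
  simp only [coeHom_apply, conjApply]
  rw [coe_fst_apply, coe_snd_apply, mul_assoc]

/-- Conjugation by a unitary multiplier as a ⋆-homomorphism. -/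
noncomputable def conj (u : unitary 𝓜(ℂ, B)) : B →⋆ₙₐ[ℂ] B where
  toFun := conjApply u
  map_smul' c x := by simp [conjApply]
  map_zero' := by simp [conjApply]
  map_add' x y := by simp [conjApply]
  map_mul' x y := by
    apply coeHom_injective
    simp only [coeHom_conjApply, map_mul]
    simp only [mul_assoc]
    rw [← mul_assoc (star (u : 𝓜(ℂ, B))) (u : 𝓜(ℂ, B)), Unitary.coe_star_mul_self, one_mul]
  map_star' x := by
    apply coeHom_injective
    simp only [coeHom_conjApply, map_star, star_mul, star_star, mul_assoc]

theorem coeHom_conj (u : unitary 𝓜(ℂ, B)) (b : B) :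
    coeHom (𝕜 := ℂ) (conj u b) = (u : 𝓜(ℂ, B)) * coeHom b * star (u : 𝓜(ℂ, B)) :=
  coeHom_conjApply u b

theorem conj_mul_apply (u v : unitary 𝓜(ℂ, B)) (b : B) :
    conj (u * v) b = conj u (conj v b) := by
  apply coeHom_injective
  simp only [coeHom_conj, Submonoid.coe_mul, star_mul, mul_assoc]

@[simp]
theorem conj_one_apply (b : B) : conj (1 : unitary 𝓜(ℂ, B)) b = b := by
  apply coeHom_injective
  simp [coeHom_conj, -coeHom_apply]

@[simp]
theorem conj_star_conj_apply (u : unitary 𝓜(ℂ, B)) (b : B) : conj (star u) (conj u b) = b := by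
  rw [← conj_mul_apply, Unitary.star_mul_self, conj_one_apply]

@[simp]
theorem conj_conj_star_apply (u : unitary 𝓜(ℂ, B)) (b : B) : conj u (conj (star u) b) = b := by
  rw [← conj_mul_apply, Unitary.mul_star_self, conj_one_apply]

theorem isometry_conj (u : unitary 𝓜(ℂ, B)) : Isometry (conj u) :=
  NonUnitalStarAlgHom.isometry _ (Function.LeftInverse.injective (conj_star_conj_apply u))

theorem norm_conj_sub (u : unitary 𝓜(ℂ, B)) (x y : B) :
    ‖(u : 𝓜(ℂ, B)) * (x : 𝓜(ℂ, B)) * star (u : 𝓜(ℂ, B)) - (y : 𝓜(ℂ, B))‖ =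
      dist (conj u x) y := by
  rw [← isometry_coeHom.dist_eq, dist_eq_norm, coeHom_conj]
  rfl

theorem infDist_conj_star {A : Type*} (u : unitary 𝓜(ℂ, B)) (b : B) (f : A → B) :
    Metric.infDist (star (u : 𝓜(ℂ, B)) * (b : 𝓜(ℂ, B)) * (u : 𝓜(ℂ, B)))
      (Set.range fun a : A => (f a : 𝓜(ℂ, B))) =
      Metric.infDist (conj (star u) b) (Set.range f) := by
  rw [← Metric.infDist_image isometry_coeHom (x := conj (star u) b), coeHom_conj, ← Set.range_comp]
  simp only [Unitary.coe_star, star_star]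
  rfl

end DoubleCentralizer

open DoubleCentralizer

theorem approxUnitaryEquiv_iff_tendsto_conj {A B : Type*} [NonUnitalCStarAlgebra A]
    [NonUnitalCStarAlgebra B] (φ ψ : A → B) :
    ApproxUnitaryEquiv φ ψ ↔ ∃ u : ℕ → unitary 𝓜(ℂ, B), ∀ a,
      Tendsto (fun n => conj (u n) (φ a)) atTop (𝓝 (ψ a)) := by
  simp only [ApproxUnitaryEquiv, norm_conj_sub]
  exact exists_congr fun u => forall_congr' fun a => tendsto_iff_dist_tendsto_zero.symm

/-- A sequence of isometric maps which is Cauchy at every point of a dense set is Cauchy at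
every point. -/
theorem cauchySeq_apply_of_isometry_of_dense {X Y : Type*} [PseudoMetricSpace X]
    [PseudoMetricSpace Y] {f : ℕ → X → Y} (hf : ∀ n, Isometry (f n)) {s : Set X} (hs : Dense s)
    (h : ∀ x ∈ s, CauchySeq fun n => f n x) (x : X) : CauchySeq fun n => f n x := by
  rw [Metric.cauchySeq_iff']
  intro ε hε
  obtain ⟨y, hy, hxy⟩ := hs.exists_dist_lt x (show 0 < ε / 3 by positivity)
  obtain ⟨N, hN⟩ := Metric.cauchySeq_iff'.1 (h y hy) (ε / 3) (by positivity)
  refine ⟨N, fun n hn => ?_⟩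
  calc dist (f n x) (f N x)
      ≤ dist (f n x) (f n y) + dist (f n y) (f N y) + dist (f N y) (f N x) := dist_triangle4 ..
    _ = dist x y + dist (f n y) (f N y) + dist x y := by
        rw [(hf n).dist_eq, (hf N).dist_eq, dist_comm y x]
    _ < ε := by linarith [hN n hn]

/-- A pointwise convergent sequence of ⋆-homomorphisms converges to a ⋆-homomorphism. -/
theorem NonUnitalStarAlgHom.exists_tendsto {A B : Type*} [NonUnitalCStarAlgebra A]
    [NonUnitalCStarAlgebra B] (θ : ℕ → A →⋆ₙₐ[ℂ] B) (h : ∀ a, CauchySeq fun n => θ n a) :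
    ∃ ψ : A →⋆ₙₐ[ℂ] B, ∀ a, Tendsto (fun n => θ n a) atTop (𝓝 (ψ a)) := by
  choose ψ hψ using fun a => cauchySeq_tendsto_of_complete (h a)
  refine ⟨{ toFun := ψ, map_smul' := fun c x => ?_, map_zero' := ?_, map_add' := fun x y => ?_,
            map_mul' := fun x y => ?_, map_star' := fun x => ?_ }, hψ⟩
  · exact tendsto_nhds_unique (hψ _) (by simpa using (hψ x).const_smul c)
  · exact tendsto_nhds_unique (hψ _) (by simp)
  · exact tendsto_nhds_unique (hψ _) (by simpa using (hψ x).add (hψ y))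
  · exact tendsto_nhds_unique (hψ _) (by simpa using (hψ x).mul (hψ y))
  · exact tendsto_nhds_unique (hψ _) (by simpa [map_star] using (hψ x).star)

/-- The unitaries of an approximate unitary equivalence with a ⋆-isomorphism yield unitaries
almost commuting with `φ(F)` and almost conjugating `G` into `φ(A)`. -/
theorem exists_unitary_of_tendsto_conj {A B : Type*} [NonUnitalCStarAlgebra B]
    (φ Φ : A → B) (hΦ : Function.Surjective Φ)
    (u : ℕ → unitary 𝓜(ℂ, B)) (hu : ∀ a, Tendsto (fun n => conj (u n) (φ a)) atTop (𝓝 (Φ a)))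
    {ε : ℝ} (hε : 0 < ε) (F : Finset A) (G : Finset B) :
    ∃ z : unitary 𝓜(ℂ, B), (∀ a ∈ F, dist (conj z (φ a)) (φ a) ≤ ε) ∧
      ∀ b ∈ G, Metric.infDist (conj (star z) b) (Set.range φ) ≤ ε := by
  have near (a : A) : ∀ᶠ n in atTop, dist (conj (u n) (φ a)) (Φ a) < ε / 2 :=
    (hu a).eventually (Metric.ball_mem_nhds _ (by positivity))
  obtain ⟨n, hn⟩ := (F.eventually_all.2 fun a _ => near a).exists
  choose c hc using fun b => hΦ (conj (u n) b)
  obtain ⟨m, hmF, hmG⟩ := ((F.eventually_all.2 fun a _ => near a).and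
    (G.eventually_all.2 fun b _ => near (c b))).exists
  refine ⟨star (u n) * u m, fun a ha => ?_, fun b hb => ?_⟩
  · rw [conj_mul_apply, ← (isometry_conj (u n)).dist_eq, conj_conj_star_apply]
    linarith [dist_triangle_right (conj (u m) (φ a)) (conj (u n) (φ a)) (Φ a), hn a ha, hmF a ha]
  · refine (Metric.infDist_le_dist_of_mem (Set.mem_range_self (c b))).trans ?_
    rw [star_mul, star_star, conj_mul_apply, ← (isometry_conj (u m)).dist_eq,
      conj_conj_star_apply, ← hc, dist_comm]
    linarith [hmG b hb]

section Intertwining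

variable {A B : Type*} [NonUnitalCStarAlgebra A] [NonUnitalCStarAlgebra B]

/-- One step of the approximate intertwining. -/
theorem exists_intertwining_step (φ : A → B)
    (H : ∀ ε : ℝ, 0 < ε → ∀ (F : Finset A) (G : Finset B), ∃ z : unitary 𝓜(ℂ, B),
      (∀ a ∈ F, dist (conj z (φ a)) (φ a) ≤ ε) ∧
      ∀ b ∈ G, Metric.infDist (conj (star z) b) (Set.range φ) ≤ ε)
    {ε : ℝ} (hε : 0 < ε) (F K : Finset A) (G : Finset B) (v : unitary 𝓜(ℂ, B)) :
    ∃ (v' : unitary 𝓜(ℂ, B)) (F' : Finset A), F ⊆ F' ∧ K ⊆ F' ∧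
      (∀ x ∈ F, dist (conj v (φ x)) (conj v' (φ x)) ≤ ε) ∧
      ∀ b ∈ G, ∃ x ∈ F', dist b (conj v' (φ x)) ≤ ε := by
  classical
  obtain ⟨z, hzF, hzG⟩ := H (ε / 2) (by positivity) F (G.image (conj (star v)))
  have approx (b : B) : ∃ x, b ∈ G → dist b (conj (v * z) (φ x)) ≤ ε := by
    by_cases hb : b ∈ G
    · have hlt := (hzG _ (Finset.mem_image_of_mem _ hb)).trans_lt (half_lt_self hε)
      obtain ⟨_, ⟨x, rfl⟩, hx⟩ := (Metric.infDist_lt_iff ⟨φ 0, Set.mem_range_self 0⟩).1 hlt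
      refine ⟨x, fun _ => ?_⟩
      rw [← conj_mul_apply, ← star_mul, ← (isometry_conj (v * z)).dist_eq,
        conj_conj_star_apply] at hx
      exact hx.le
    · exact ⟨0, fun h => absurd h hb⟩
  choose c hc using approx
  refine ⟨v * z, F ∪ K ∪ G.image c, fun x hx => by simp [hx], fun x hx => by simp [hx],
    fun x hx => ?_, fun b hb => ⟨c b, Finset.mem_union_right _ (Finset.mem_image_of_mem _ hb),
      hc b hb⟩⟩
  rw [conj_mul_apply, (isometry_conj v).dist_eq, dist_comm]
  exact (hzF x hx).trans (half_le_self hε.le)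

/-- The approximate intertwining argument: almost commuting unitaries which almost conjugate `B`
into `φ(A)` produce a ⋆-isomorphism approximately unitarily equivalent to `φ`. -/
theorem exists_starAlgEquiv_tendsto_conj [TopologicalSpace.SeparableSpace A]
    [TopologicalSpace.SeparableSpace B] (φ : A →⋆ₙₐ[ℂ] B) (hinj : Function.Injective φ)
    (H : ∀ ε : ℝ, 0 < ε → ∀ (F : Finset A) (G : Finset B), ∃ z : unitary 𝓜(ℂ, B),
      (∀ a ∈ F, dist (conj z (φ a)) (φ a) ≤ ε) ∧
      ∀ b ∈ G, Metric.infDist (conj (star z) b) (Set.range φ) ≤ ε) :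
    ∃ (Φ : A ≃⋆ₐ[ℂ] B) (u : ℕ → unitary 𝓜(ℂ, B)),
      ∀ a, Tendsto (fun n => conj (u n) (φ a)) atTop (𝓝 (Φ a)) := by
  classical
  let a := TopologicalSpace.denseSeq A
  let b := TopologicalSpace.denseSeq B
  choose v' F' hF hK hv hb using fun (n : ℕ) (s : unitary 𝓜(ℂ, B) × Finset A) =>
    exists_intertwining_step φ H (show (0 : ℝ) < 1 / 2 ^ n by positivity) s.2 {a n}
      ((Finset.range (n + 1)).image b) s.1
  obtain ⟨S, hS_succ⟩ : ∃ S : ℕ → unitary 𝓜(ℂ, B) × Finset A,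
      ∀ n, S (n + 1) = (v' n (S n), F' n (S n)) :=
    ⟨fun n => Nat.rec (1, ∅) (fun n s => (v' n s, F' n s)) n, fun _ => rfl⟩
  let θ (n : ℕ) : A →⋆ₙₐ[ℂ] B := (conj (S n).1).comp φ
  have hS : Monotone fun n => (S n).2 := monotone_nat_of_le_succ fun n => by
    rw [hS_succ]
    exact hF n (S n)
  have hθ (n : ℕ) : Isometry (θ n) :=
    (isometry_conj _).comp (NonUnitalStarAlgHom.isometry φ hinj)
  have step {N : ℕ} {x : A} (hx : x ∈ (S N).2) (k : ℕ) :
      dist (θ (k + N) x) (θ (k + 1 + N) x) ≤ 2 / 2 ^ N / 2 / 2 ^ k := by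
    have h := hv (k + N) (S (k + N)) x (hS (Nat.le_add_left N k) hx)
    have hstep : θ (k + 1 + N) x = conj (v' (k + N) (S (k + N))) (φ x) := by
      rw [add_right_comm]
      simp only [θ, hS_succ, NonUnitalStarAlgHom.comp_apply]
    rw [hstep]
    refine h.trans_eq ?_
    rw [pow_add]
    field_simp
  have cauchy (x : A) : CauchySeq fun n => θ n x := by
    refine cauchySeq_apply_of_isometry_of_dense hθ (TopologicalSpace.denseRange_denseSeq A) ?_ x
    rintro _ ⟨N, rfl⟩
    have hmem : a N ∈ (S (N + 1)).2 := by
      rw [hS_succ]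
      exact hK N (S N) (Finset.mem_singleton_self _)
    exact (cauchySeq_shift (N + 1)).1 (cauchySeq_of_le_geometric_two (step hmem))
  obtain ⟨ψ, hψ⟩ := NonUnitalStarAlgHom.exists_tendsto θ cauchy
  have hψ_isom : Isometry ψ := Isometry.of_dist_eq fun x y =>
    tendsto_nhds_unique ((hψ x).dist (hψ y)) (by simp [(hθ _).dist_eq])
  have hrange (j : ℕ) : b j ∈ closure (Set.range ψ) := by
    rw [Metric.mem_closure_iff]
    intro ε hε
    have hlim : Tendsto (fun n : ℕ => 2 * (1 / 2 : ℝ) ^ n) atTop (𝓝 0) := by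
      simpa using (tendsto_pow_atTop_nhds_zero_of_lt_one (r := (1 / 2 : ℝ))
        (by norm_num) (by norm_num)).const_mul 2
    obtain ⟨n, hn, hjn⟩ := ((hlim.eventually_lt_const hε).and (eventually_ge_atTop j)).exists
    obtain ⟨x, hx, hbx⟩ := hb n (S n) (b j)
      (Finset.mem_image_of_mem _ (Finset.mem_range.2 (by lia)))
    have h₁ : dist (b j) (θ (n + 1) x) ≤ 1 / 2 ^ n := by
      simpa only [θ, hS_succ, NonUnitalStarAlgHom.comp_apply] using hbx
    have hmem : x ∈ (S (n + 1)).2 := by rwa [hS_succ]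
    have h₂ : dist (θ (n + 1) x) (ψ x) ≤ 2 / 2 ^ (n + 1) := by
      have h := dist_le_of_le_geometric_two_of_tendsto₀ (step hmem)
        ((tendsto_add_atTop_iff_nat (n + 1)).2 (hψ x))
      simpa using h
    refine ⟨ψ x, Set.mem_range_self x, ?_⟩
    calc dist (b j) (ψ x) ≤ 1 / 2 ^ n + 2 / 2 ^ (n + 1) :=
          (dist_triangle _ _ _).trans (add_le_add h₁ h₂)
      _ = 2 * (1 / 2) ^ n := by
          rw [pow_succ, one_div_pow]
          field_simp
          norm_num
      _ < ε := hn
  have hclosed : IsClosed (Set.range ψ) := hψ_isom.isClosedEmbedding.isClosed_range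
  have hsurj : Function.Surjective ψ := by
    have hdense := (TopologicalSpace.denseRange_denseSeq B).mono
      (Set.range_subset_iff.2 fun j => hclosed.closure_eq ▸ hrange j)
    rw [← Set.range_eq_univ, ← hclosed.closure_eq, hdense.closure_eq]
  exact ⟨StarAlgEquiv.ofBijective ψ ⟨hψ_isom.injective, hsurj⟩, fun n => (S n).1, hψ⟩

end Intertwining

/-- An injective ⋆-homomorphism `φ : A → B` between separable C⋆-algebras is
approximately unitarily equivalent to a ⋆-isomorphism of `A` onto `B` if and only if for every
`ε > 0` and finite sets `F ⊆ A`, `G ⊆ B` there is a unitary `z ∈ U(𝓜(ℂ, B))` almost commuting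
with `φ(F)` and almost conjugating `G` into `φ(A)`. -/
theorem stmt5 {A B : Type*}
    [NonUnitalCStarAlgebra A] [NonUnitalCStarAlgebra B]
    [TopologicalSpace.SeparableSpace A] [TopologicalSpace.SeparableSpace B]
    (φ : A →⋆ₙₐ[ℂ] B) (hinj : Function.Injective φ) :
    (∃ Φ : A ≃⋆ₐ[ℂ] B, ApproxUnitaryEquiv (⇑φ) (⇑Φ)) ↔
      (∀ ε : ℝ, 0 < ε → ∀ (F : Finset A) (G : Finset B),
        ∃ z : unitary 𝓜(ℂ, B),
          (∀ a ∈ F,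
            ‖(z : 𝓜(ℂ, B)) * (φ a : 𝓜(ℂ, B)) * star (z : 𝓜(ℂ, B)) - (φ a : 𝓜(ℂ, B))‖ ≤ ε) ∧
          (∀ b ∈ G,
            Metric.infDist (star (z : 𝓜(ℂ, B)) * (b : 𝓜(ℂ, B)) * (z : 𝓜(ℂ, B)))
              (Set.range fun a : A => (φ a : 𝓜(ℂ, B))) ≤ ε)) := by
  simp only [approxUnitaryEquiv_iff_tendsto_conj, norm_conj_sub, infDist_conj_star]
  constructor
  · rintro ⟨Φ, u, hu⟩ ε hε F G
    exact exists_unitary_of_tendsto_conj φ Φ Φ.surjective u hu hε F G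
  · exact exists_starAlgEquiv_tendsto_conj φ hinj
end

section
/- Let A and B be separable C*-algebras and let φ: A → B be an injective *-homomorphism. Then φ is asymptotically unitarily equivalent to a *-isomorphism from A onto B if and only if: for every ε > 0 and all finite sets F ⊆ A and G ⊆ B, there exists a strictly continuous path z: [0,1] → U(M(B)) with z_0 = 1 such that sup_{0 ≤ t ≤ 1} ‖z_t φ(a) z_t* − φ(a)‖ ≤ ε for all a ∈ F, and dist(z_1* b z_1, φ(A)) ≤ ε for all b ∈ G. -/
open Filter Topology MultiplierAlgebra

/-- Two maps `A → B` are asymptotically unitarily equivalent if there is a strictly continuous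
path `u : [0,∞) → U(𝓜(ℂ, B))` of unitaries with `u_t φ(a) u_t* → ψ(a)` in norm as `t → ∞`. -/
def AsympUnitaryEquiv {A B : Type*} [NonUnitalCStarAlgebra A] [NonUnitalCStarAlgebra B]
    (φ ψ : A → B) : Prop :=
  ∃ u : ℝ → unitary 𝓜(ℂ, B),
    (∀ b : B,
      ContinuousOn (fun t => ((u t : 𝓜(ℂ, B)) * (b : 𝓜(ℂ, B)))) (Set.Ici (0 : ℝ)) ∧
      ContinuousOn (fun t => ((b : 𝓜(ℂ, B)) * (u t : 𝓜(ℂ, B)))) (Set.Ici (0 : ℝ))) ∧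
    ∀ a : A,
      Tendsto
        (fun t => ‖(u t : 𝓜(ℂ, B)) * (φ a : 𝓜(ℂ, B)) * star (u t : 𝓜(ℂ, B)) - (ψ a : 𝓜(ℂ, B))‖)
        atTop (𝓝 (0 : ℝ))

section Conjugation

variable {M : Type*} [CStarAlgebra M]

theorem norm_unitary_conj (U : unitary M) (x : M) : ‖(U : M) * x * star (U : M)‖ = ‖x‖ := by
  rw [CStarRing.norm_mul_mem_unitary _ (Unitary.star_mem U.2), CStarRing.norm_mem_unitary_mul _ U.2]

theorem norm_star_unitary_conj (U : unitary M) (x : M) : ‖star (U : M) * x * (U : M)‖ = ‖x‖ := by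
  rw [CStarRing.norm_mul_mem_unitary _ U.2, CStarRing.norm_mem_unitary_mul _ (Unitary.star_mem U.2)]

theorem norm_star_conj_sub (U : unitary M) (x y : M) :
    ‖star (U : M) * x * (U : M) - y‖ = ‖(U : M) * y * star (U : M) - x‖ := by
  rw [← norm_unitary_conj U, norm_sub_rev]
  simp [mul_sub, sub_mul, ← mul_assoc]
  simp [mul_assoc]

theorem unitary_conj_mul_sub (U V : unitary M) (x : M) :
    ‖((U * V : unitary M) : M) * x * star ((U * V : unitary M) : M) - (U : M) * x * star (U : M)‖ =
      ‖(V : M) * x * star (V : M) - x‖ := by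
  rw [← norm_unitary_conj U ((V : M) * x * star (V : M) - x)]
  simp [mul_sub, sub_mul, mul_assoc]

end Conjugation

section Limit

variable {A B M T : Type*} [NonUnitalCStarAlgebra A] [NonUnitalCStarAlgebra B] [CStarAlgebra M]

/-- A pointwise limit of ⋆-homomorphisms with values in a subalgebra is a ⋆-homomorphism. -/
theorem exists_starAlgHom_of_tendsto {l : Filter T} [l.NeBot] (ι : B →⋆ₙₐ[ℂ] M)
    (hι : Function.Injective ι) (v : T → A →⋆ₙₐ[ℂ] M)
    (h : ∀ a, ∃ b, Tendsto (fun t => v t a) l (𝓝 (ι b))) :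
    ∃ Ψ : A →⋆ₙₐ[ℂ] B, ∀ a, Tendsto (fun t => v t a) l (𝓝 (ι (Ψ a))) := by
  choose Ψ hΨ using h
  have key {a : A} {b : B} (hb : Tendsto (fun t => v t a) l (𝓝 (ι b))) : Ψ a = b :=
    hι (tendsto_nhds_unique (hΨ a) hb)
  exact ⟨{
    toFun := Ψ
    map_smul' c a := key (by simpa using (hΨ a).const_smul c)
    map_zero' := key (by simp)
    map_add' a b := key (by simpa using (hΨ a).add (hΨ b))
    map_mul' a b := key (by simpa using (hΨ a).mul (hΨ b))
    map_star' a := key (by simpa [map_star] using (hΨ a).star) }, hΨ⟩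

/-- If injective ⋆-homomorphisms into an algebra converge pointwise, with limits in a
subalgebra which they asymptotically exhaust, then the limit is a ⋆-isomorphism. -/
theorem exists_starAlgEquiv_of_cauchySeq [Nonempty T] [SemilatticeSup T] (ι : B →⋆ₙₐ[ℂ] M)
    (hι : Function.Injective ι) (v : T → A →⋆ₙₐ[ℂ] M) (hv : ∀ t, Function.Injective (v t))
    (hr : ∀ t a, v t a ∈ Set.range ι) (hc : ∀ a, CauchySeq fun t => v t a)
    {S : Set B} (hS : Dense S)
    (hd : ∀ b ∈ S, ∀ ε > 0, ∃ a, ∀ᶠ t in atTop, ‖v t a - ι b‖ ≤ ε) :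
    ∃ Φ : A ≃⋆ₐ[ℂ] B, ∀ a, Tendsto (fun t => v t a) atTop (𝓝 (ι (Φ a))) := by
  have hιi := NonUnitalStarAlgHom.isometry ι hι
  obtain ⟨Ψ, hΨ⟩ := exists_starAlgHom_of_tendsto (l := atTop) ι hι v fun a => by
    obtain ⟨x, hx⟩ := cauchySeq_tendsto_of_complete (hc a)
    obtain ⟨b, rfl⟩ := hιi.isClosedEmbedding.isClosed_range.mem_of_tendsto hx
      (Eventually.of_forall fun t => hr t a)
    exact ⟨b, hx⟩
  have hΨn (a : A) : ‖Ψ a‖ = ‖a‖ := by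
    have := (hΨ a).norm
    simp only [NonUnitalStarAlgHom.norm_map _ (hv _), NonUnitalStarAlgHom.norm_map _ hι] at this
    exact tendsto_nhds_unique this tendsto_const_nhds
  have hΨi : Isometry Ψ := AddMonoidHomClass.isometry_of_norm Ψ hΨn
  have hsurj : Function.Surjective Ψ := by
    rw [← Set.range_eq_univ, ← hΨi.isClosedEmbedding.isClosed_range.closure_eq,
      ← Set.univ_subset_iff, ← hS.closure_eq]
    refine closure_minimal (fun b hb => Metric.mem_closure_range_iff.2 fun ε hε => ?_)
      isClosed_closure
    obtain ⟨a, ha⟩ := hd b hb (ε / 2) (half_pos hε)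
    refine ⟨a, ?_⟩
    rw [dist_comm, dist_eq_norm, ← NonUnitalStarAlgHom.norm_map ι hι, map_sub]
    exact (le_of_tendsto ((hΨ a).sub_const _).norm ha).trans_lt (half_lt_self hε)
  exact ⟨StarAlgEquiv.ofBijective Ψ ⟨hΨi.injective, hsurj⟩, hΨ⟩

end Limit

theorem CStarRing.eq_of_forall_mul_eq {R : Type*} [NonUnitalNormedRing R] [StarRing R]
    [CStarRing R] {b c : R} (h : ∀ z, z * b = z * c) : b = c := by
  rw [← sub_eq_zero, ← CStarRing.star_mul_self_eq_zero_iff, mul_sub, h, sub_self]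

section Multiplier

variable {B : Type*} [NonUnitalCStarAlgebra B]

theorem DoubleCentralizer.mul_coe (m : 𝓜(ℂ, B)) (b : B) :
    m * (b : 𝓜(ℂ, B)) = ((m.fst b : B) : 𝓜(ℂ, B)) := by
  have h (x y : B) : m.fst (x * y) = m.fst x * y := by
    refine CStarRing.eq_of_forall_mul_eq fun z => ?_
    rw [← m.central, ← mul_assoc, ← mul_assoc, m.central]
  ext x
  · simpa using h b x
  · simpa using m.central x b

theorem DoubleCentralizer.coe_mul (m : 𝓜(ℂ, B)) (b : B) :
    (b : 𝓜(ℂ, B)) * m = ((m.snd b : B) : 𝓜(ℂ, B)) := by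
  have h := congrArg star (mul_coe (star m) (star b))
  have hs (c : B) : star (c : 𝓜(ℂ, B)) = ((star c : B) : 𝓜(ℂ, B)) :=
    (map_star (coeHom : B →⋆ₙₐ[ℂ] 𝓜(ℂ, B)) c).symm
  simpa [hs] using h

theorem DoubleCentralizer.coeHom_injective_s6 :
    Function.Injective (DoubleCentralizer.coeHom : B →⋆ₙₐ[ℂ] 𝓜(ℂ, B)) := by
  intro b c h
  refine CStarRing.eq_of_forall_mul_eq fun z => ?_
  exact congrArg (fun m : 𝓜(ℂ, B) => m.snd z) h

/-- Strict continuity on a set of a path in the multiplier algebra. -/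
def StrictContinuousOn (u : ℝ → 𝓜(ℂ, B)) (s : Set ℝ) : Prop :=
  ∀ b : B, ContinuousOn (fun t => u t * (b : 𝓜(ℂ, B))) s ∧
    ContinuousOn (fun t => (b : 𝓜(ℂ, B)) * u t) s

theorem StrictContinuousOn.const_mul {u : ℝ → 𝓜(ℂ, B)} {s : Set ℝ} (hu : StrictContinuousOn u s)
    (m : 𝓜(ℂ, B)) : StrictContinuousOn (fun t => m * u t) s := fun b => by
  simp only [mul_assoc, ← mul_assoc (b : 𝓜(ℂ, B)), DoubleCentralizer.coe_mul m b]
  exact ⟨continuousOn_const.mul (hu b).1, (hu _).2⟩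

theorem StrictContinuousOn.comp {u : ℝ → 𝓜(ℂ, B)} {s t : Set ℝ} (hu : StrictContinuousOn u s)
    {f : ℝ → ℝ} (hf : ContinuousOn f t) (hft : Set.MapsTo f t s) :
    StrictContinuousOn (fun x => u (f x)) t := fun b =>
  ⟨(hu b).1.comp hf hft, (hu b).2.comp hf hft⟩

theorem StrictContinuousOn.congr {u v : ℝ → 𝓜(ℂ, B)} {s : Set ℝ} (hu : StrictContinuousOn u s)
    (h : Set.EqOn v u s) : StrictContinuousOn v s := fun b =>
  ⟨(hu b).1.congr fun t ht => by simp only [h ht], (hu b).2.congr fun t ht => by simp only [h ht]⟩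

end Multiplier

theorem continuousOn_Ici_of_forall_Icc {X : Type*} [TopologicalSpace X] {f : ℝ → X}
    (h : ∀ n : ℕ, ContinuousOn f (Set.Icc (n : ℝ) (n + 1))) : ContinuousOn f (Set.Ici 0) := by
  have hn (n : ℕ) : ContinuousOn f (Set.Icc 0 (n : ℝ)) := by
    induction n with
    | zero => simp
    | succ n ih =>
      have := ih.union_of_isClosed (h n) isClosed_Icc isClosed_Icc
      rwa [Set.Icc_union_Icc_eq_Icc n.cast_nonneg (by linarith), ← Nat.cast_succ] at this
  intro t ht
  obtain ⟨n, htn⟩ := exists_nat_gt t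
  refine (hn n t ⟨ht, htn.le⟩).mono_of_mem_nhdsWithin ?_
  rw [← Set.Ici_inter_Iic]
  exact inter_mem_nhdsWithin _ (Iic_mem_nhds htn)

section Intertwining

variable {A B : Type*} [NonUnitalCStarAlgebra A] [NonUnitalCStarAlgebra B]

theorem exists_path_of_asympUnitaryEquiv {φ : A → B} {Φ : A ≃ B} (h : AsympUnitaryEquiv φ Φ)
    {ε : ℝ} (hε : 0 < ε) (F : Finset A) (G : Finset B) :
    ∃ z : ℝ → unitary 𝓜(ℂ, B),
      StrictContinuousOn (fun t => (z t : 𝓜(ℂ, B))) (Set.Icc 0 1) ∧ z 0 = 1 ∧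
      (∀ t ∈ Set.Icc (0 : ℝ) 1, ∀ a ∈ F,
        ‖(z t : 𝓜(ℂ, B)) * (φ a : 𝓜(ℂ, B)) * star (z t : 𝓜(ℂ, B)) - (φ a : 𝓜(ℂ, B))‖ ≤ ε) ∧
      ∀ b ∈ G, Metric.infDist (star (z 1 : 𝓜(ℂ, B)) * (b : 𝓜(ℂ, B)) * (z 1 : 𝓜(ℂ, B)))
        (Set.range fun a : A => (φ a : 𝓜(ℂ, B))) ≤ ε := by
  obtain ⟨u, hu, hlim⟩ := h
  have hev (a : A) {δ : ℝ} (hδ : 0 < δ) : ∀ᶠ t in atTop, ‖(u t : 𝓜(ℂ, B)) * (φ a : 𝓜(ℂ, B)) *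
      star (u t : 𝓜(ℂ, B)) - (Φ a : 𝓜(ℂ, B))‖ < δ := (hlim a).eventually_lt_const hδ
  obtain ⟨s, hs⟩ := eventually_atTop.1
    (((Finset.eventually_all F).2 fun a _ => hev a (half_pos hε)).and (eventually_ge_atTop 0))
  have hs0 : 0 ≤ s := (hs s le_rfl).2
  let c (b : B) : B := (star (u s : 𝓜(ℂ, B))).snd ((u s : 𝓜(ℂ, B)).fst b)
  have hc (b : B) : (c b : 𝓜(ℂ, B)) = (u s : 𝓜(ℂ, B)) * (b : 𝓜(ℂ, B)) * star (u s : 𝓜(ℂ, B)) := by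
    rw [DoubleCentralizer.mul_coe, DoubleCentralizer.coe_mul]
  obtain ⟨r, hr, hsr⟩ :=
    (((Finset.eventually_all G).2 fun b _ => hev (Φ.symm (c b)) hε).and
      (eventually_ge_atTop s)).exists
  have hmaps : Set.MapsTo (fun t : ℝ => s + t * (r - s)) (Set.Icc 0 1) (Set.Ici s) := fun t ht =>
    le_add_of_nonneg_right (mul_nonneg ht.1 (sub_nonneg.2 hsr))
  refine ⟨fun t => star (u s) * u (s + t * (r - s)), ?_, by simp, fun t ht a ha => ?_,
    fun b hb => ?_⟩
  · exact (StrictContinuousOn.comp hu (by fun_prop)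
      (hmaps.mono_right (Set.Ici_subset_Ici.2 hs0))).const_mul (star (u s : 𝓜(ℂ, B)))
  · have h1 := (hs _ (hmaps ht)).1 a ha
    have h2 := (hs s le_rfl).1 a ha
    have h3 := norm_star_unitary_conj (u s)
      ((u (s + t * (r - s)) : 𝓜(ℂ, B)) * (φ a : 𝓜(ℂ, B)) * star (u (s + t * (r - s)) : 𝓜(ℂ, B)) -
        (u s : 𝓜(ℂ, B)) * (φ a : 𝓜(ℂ, B)) * star (u s : 𝓜(ℂ, B)))
    have h4 : star (u s : 𝓜(ℂ, B)) * ((u s : 𝓜(ℂ, B)) * (φ a : 𝓜(ℂ, B)) *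
        star (u s : 𝓜(ℂ, B))) * (u s : 𝓜(ℂ, B)) = φ a := by
      simp [mul_assoc]; simp [← mul_assoc]
    rw [mul_sub, sub_mul, h4] at h3
    rw [norm_sub_rev] at h2
    simp only [Submonoid.coe_mul, star_mul, Unitary.coe_star, star_star]
    simp only [mul_assoc] at h3 h1 h2 ⊢
    rw [h3]
    exact (norm_sub_le_norm_sub_add_norm_sub _ _ _).trans (by linarith)
  · refine (Metric.infDist_le_dist_of_mem (Set.mem_range_self (Φ.symm (c b)))).trans ?_
    have h1 := hr b hb
    rw [Φ.apply_symm_apply, hc, ← norm_star_conj_sub] at h1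
    rw [dist_eq_norm]
    simpa [mul_assoc] using h1.le

theorem exists_sequence_of_forall_exists {X : Type*} (x₀ : X) {R : ℕ → X → X → Prop}
    (h : ∀ n x, ∃ y, R n x y) : ∃ x : ℕ → X, x 0 = x₀ ∧ ∀ n, R n (x n) (x (n + 1)) := by
  choose f hf using h
  exact ⟨fun n => Nat.rec x₀ f n, rfl, fun n => hf n _⟩

/-- Concatenation of the paths `z n` in the unitary group, where `U n` is the starting point of
the `n`-th piece. -/
noncomputable def concatPath {G : Type*} [Mul G] (U : ℕ → G) (z : ℕ → ℝ → G) (t : ℝ) : G :=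
  U ⌊t⌋₊ * z ⌊t⌋₊ (t - ⌊t⌋₊)

theorem concatPath_eqOn {G : Type*} [Monoid G] {U : ℕ → G} {z : ℕ → ℝ → G} (hz : ∀ n, z n 0 = 1)
    (hU : ∀ n, U (n + 1) = U n * z n 1) (n : ℕ) :
    Set.EqOn (concatPath U z) (fun t => U n * z n (t - n)) (Set.Icc n (n + 1)) := by
  rintro t ⟨h1, h2⟩
  rcases h2.eq_or_lt with rfl | h2
  · have : ⌊(n : ℝ) + 1⌋₊ = n + 1 := by exact_mod_cast Nat.floor_natCast (R := ℝ) (n + 1)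
    simp [concatPath, this, hz, hU]
  · have : ⌊t⌋₊ = n := (Nat.floor_eq_iff (n.cast_nonneg.trans h1)).2 ⟨h1, h2⟩
    simp [concatPath, this]

theorem strictContinuousOn_concatPath {U : ℕ → unitary 𝓜(ℂ, B)} {z : ℕ → ℝ → unitary 𝓜(ℂ, B)}
    (hz : ∀ n, z n 0 = 1) (hU : ∀ n, U (n + 1) = U n * z n 1)
    (hc : ∀ n, StrictContinuousOn (fun t => (z n t : 𝓜(ℂ, B))) (Set.Icc 0 1)) :
    StrictContinuousOn (fun t => ((concatPath U z t : unitary 𝓜(ℂ, B)) : 𝓜(ℂ, B))) (Set.Ici 0) := by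
  have h (n : ℕ) : StrictContinuousOn (fun t => ((concatPath U z t : unitary 𝓜(ℂ, B)) : 𝓜(ℂ, B)))
      (Set.Icc n (n + 1)) := by
    refine StrictContinuousOn.congr (((hc n).comp (f := fun t => t - n) (by fun_prop)
      fun t ht => ⟨?_, ?_⟩).const_mul (U n : 𝓜(ℂ, B)))
      fun t ht => congrArg Subtype.val (concatPath_eqOn hz hU n ht)
    · exact sub_nonneg.2 ht.1
    · exact sub_le_iff_le_add'.2 ht.2
  exact fun b => ⟨continuousOn_Ici_of_forall_Icc fun n => (h n b).1,
    continuousOn_Ici_of_forall_Icc fun n => (h n b).2⟩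

theorem norm_concatPath_conj_sub_le {M : Type*} [CStarAlgebra M] {U : ℕ → unitary M}
    {z : ℕ → ℝ → unitary M} (hU : ∀ n, U (n + 1) = U n * z n 1) {x : M}
    {n : ℕ} (hx : ∀ k ≥ n, ∀ t ∈ Set.Icc (0 : ℝ) 1,
      ‖(z k t : M) * x * star (z k t : M) - x‖ ≤ (1 / 2) ^ k) {t : ℝ} (ht : n ≤ t) :
    ‖((concatPath U z t : unitary M) : M) * x * star ((concatPath U z t : unitary M) : M) -
      (U n : M) * x * star (U n : M)‖ ≤
      2 * (1 / 2) ^ n := by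
  have hstep (k : ℕ) (hk : n ≤ k) : ‖(U k : M) * x * star (U k : M) -
      (U n : M) * x * star (U n : M)‖ ≤ 2 * (1 / 2) ^ n - 2 * (1 / 2) ^ k := by
    induction k, hk using Nat.le_induction with
    | base => simp
    | succ k hk ih =>
      have h1 := hx k hk 1 (by simp)
      rw [← unitary_conj_mul_sub (U k), ← hU] at h1
      refine (norm_sub_le_norm_sub_add_norm_sub _ _ _).trans ((add_le_add h1 ih).trans ?_)
      rw [pow_succ]
      linarith
  have ht0 : 0 ≤ t := n.cast_nonneg.trans ht
  have h1 := hx ⌊t⌋₊ (Nat.le_floor ht) (t - ⌊t⌋₊)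
    ⟨sub_nonneg.2 (Nat.floor_le ht0), by linarith [Nat.lt_floor_add_one t]⟩
  rw [← unitary_conj_mul_sub (U ⌊t⌋₊)] at h1
  refine (norm_sub_le_norm_sub_add_norm_sub _ _ _).trans
    ((add_le_add h1 (hstep _ (Nat.le_floor ht))).trans ?_)
  have : (0 : ℝ) < (1 / 2) ^ ⌊t⌋₊ := by positivity
  linarith

theorem exists_intertwining_sequence [TopologicalSpace.SeparableSpace A] (φ : A → B)
    (h : ∀ ε : ℝ, 0 < ε → ∀ (F : Finset A) (G : Finset B), ∃ z : ℝ → unitary 𝓜(ℂ, B),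
      StrictContinuousOn (fun t => (z t : 𝓜(ℂ, B))) (Set.Icc 0 1) ∧ z 0 = 1 ∧
      (∀ t ∈ Set.Icc (0 : ℝ) 1, ∀ a ∈ F,
        ‖(z t : 𝓜(ℂ, B)) * (φ a : 𝓜(ℂ, B)) * star (z t : 𝓜(ℂ, B)) - (φ a : 𝓜(ℂ, B))‖ ≤ ε) ∧
      ∀ b ∈ G, Metric.infDist (star (z 1 : 𝓜(ℂ, B)) * (b : 𝓜(ℂ, B)) * (z 1 : 𝓜(ℂ, B)))
        (Set.range fun a : A => (φ a : 𝓜(ℂ, B))) ≤ ε) (α : ℕ → A) (β : ℕ → B) :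
    ∃ (U : ℕ → unitary 𝓜(ℂ, B)) (z : ℕ → ℝ → unitary 𝓜(ℂ, B)) (F : ℕ → Finset A),
      (∀ n, z n 0 = 1) ∧ (∀ n, U (n + 1) = U n * z n 1) ∧
      (∀ n, StrictContinuousOn (fun t => (z n t : 𝓜(ℂ, B))) (Set.Icc 0 1)) ∧
      Monotone F ∧ (∀ n, α n ∈ F (n + 1)) ∧
      (∀ n, ∀ t ∈ Set.Icc (0 : ℝ) 1, ∀ a ∈ F n, ‖(z n t : 𝓜(ℂ, B)) * (φ a : 𝓜(ℂ, B)) *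
        star (z n t : 𝓜(ℂ, B)) - (φ a : 𝓜(ℂ, B))‖ ≤ (1 / 2) ^ n) ∧
      ∀ n, ∀ j ≤ n, ∃ a ∈ F (n + 1), ‖(U (n + 1) : 𝓜(ℂ, B)) * (φ a : 𝓜(ℂ, B)) *
        star (U (n + 1) : 𝓜(ℂ, B)) - (β j : 𝓜(ℂ, B))‖ ≤ 2 * (1 / 2) ^ n := by
  classical
  obtain ⟨x, -, hx⟩ := exists_sequence_of_forall_exists
    (X := unitary 𝓜(ℂ, B) × Finset A × (ℝ → unitary 𝓜(ℂ, B))) (1, ∅, fun _ => 1)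
    (R := fun n p q => q.2.2 0 = 1 ∧ q.1 = p.1 * q.2.2 1 ∧
      StrictContinuousOn (fun t => (q.2.2 t : 𝓜(ℂ, B))) (Set.Icc 0 1) ∧
      p.2.1 ⊆ q.2.1 ∧ α n ∈ q.2.1 ∧
      (∀ t ∈ Set.Icc (0 : ℝ) 1, ∀ a ∈ p.2.1, ‖(q.2.2 t : 𝓜(ℂ, B)) * (φ a : 𝓜(ℂ, B)) *
        star (q.2.2 t : 𝓜(ℂ, B)) - (φ a : 𝓜(ℂ, B))‖ ≤ (1 / 2) ^ n) ∧
      ∀ j ≤ n, ∃ a ∈ q.2.1, ‖(q.1 : 𝓜(ℂ, B)) * (φ a : 𝓜(ℂ, B)) *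
        star (q.1 : 𝓜(ℂ, B)) - (β j : 𝓜(ℂ, B))‖ ≤ 2 * (1 / 2) ^ n) <| by
    rintro n ⟨U, F, -⟩
    have hε : (0 : ℝ) < (1 / 2) ^ n := by positivity
    let c (j : ℕ) : B := (U : 𝓜(ℂ, B)).snd ((star (U : 𝓜(ℂ, B))).fst (β j))
    have hc (j : ℕ) : (c j : 𝓜(ℂ, B)) = star (U : 𝓜(ℂ, B)) * (β j : 𝓜(ℂ, B)) * U := by
      rw [DoubleCentralizer.mul_coe, DoubleCentralizer.coe_mul]
    obtain ⟨z, hz, hz0, hzF, hzG⟩ := h _ hε F ((Finset.range (n + 1)).image c)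
    have hex (j : ℕ) : ∃ a, j ≤ n → ‖((U * z 1 : unitary 𝓜(ℂ, B)) : 𝓜(ℂ, B)) * (φ a : 𝓜(ℂ, B)) *
        star ((U * z 1 : unitary 𝓜(ℂ, B)) : 𝓜(ℂ, B)) - (β j : 𝓜(ℂ, B))‖ ≤ 2 * (1 / 2) ^ n := by
      by_cases hj : j ≤ n
      · have h1 := (hzG (c j) (Finset.mem_image_of_mem c (by simpa [Nat.lt_succ_iff] using hj))).trans_lt
          (lt_two_mul_self hε)
        obtain ⟨_, ⟨a, rfl⟩, ha⟩ := (Metric.infDist_lt_iff ⟨_, Set.mem_range_self (α 0)⟩).1 h1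
        refine ⟨a, fun _ => ?_⟩
        rw [← norm_star_conj_sub]
        rw [dist_eq_norm, hc] at ha
        simpa [mul_assoc] using ha.le
      · exact ⟨α 0, fun hj' => absurd hj' hj⟩
    choose a ha using hex
    exact ⟨(U * z 1, F ∪ {α n} ∪ (Finset.range (n + 1)).image a, z), hz0, rfl, hz,
      fun y hy => by simp [hy], by simp, hzF, fun j hj => ⟨a j, Finset.mem_union_right _
        (Finset.mem_image_of_mem a (by simpa [Nat.lt_succ_iff] using hj)), ha j hj⟩⟩
  exact ⟨fun n => (x n).1, fun n => (x (n + 1)).2.2, fun n => (x n).2.1, fun n => (hx n).1,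
    fun n => (hx n).2.1, fun n => (hx n).2.2.1, monotone_nat_of_le_succ fun n => (hx n).2.2.2.1,
    fun n => (hx n).2.2.2.2.1, fun n => (hx n).2.2.2.2.2.1, fun n => (hx n).2.2.2.2.2.2⟩

/-- Conjugation of a ⋆-homomorphism by a unitary of the multiplier algebra. -/
noncomputable def conjHom (φ : A →⋆ₙₐ[ℂ] B) (U : unitary 𝓜(ℂ, B)) : A →⋆ₙₐ[ℂ] 𝓜(ℂ, B) :=
  ((Unitary.conjStarAlgAut ℂ 𝓜(ℂ, B) U : 𝓜(ℂ, B) →⋆ₙₐ[ℂ] 𝓜(ℂ, B)).comp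
    DoubleCentralizer.coeHom).comp φ

theorem conjHom_apply (φ : A →⋆ₙₐ[ℂ] B) (U : unitary 𝓜(ℂ, B)) (a : A) :
    conjHom φ U a = (U : 𝓜(ℂ, B)) * (φ a : 𝓜(ℂ, B)) * star (U : 𝓜(ℂ, B)) := rfl

theorem conjHom_injective {φ : A →⋆ₙₐ[ℂ] B} (hφ : Function.Injective φ) (U : unitary 𝓜(ℂ, B)) :
    Function.Injective (conjHom φ U) :=
  (Unitary.conjStarAlgAut ℂ 𝓜(ℂ, B) U).injective.comp
    (DoubleCentralizer.coeHom_injective_s6.comp hφ)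

theorem conjHom_mem_range (φ : A →⋆ₙₐ[ℂ] B) (U : unitary 𝓜(ℂ, B)) (a : A) :
    conjHom φ U a ∈ Set.range (DoubleCentralizer.coeHom : B →⋆ₙₐ[ℂ] 𝓜(ℂ, B)) := by
  rw [conjHom_apply, DoubleCentralizer.mul_coe, DoubleCentralizer.coe_mul]
  exact ⟨_, rfl⟩

theorem exists_asympUnitaryEquiv_of_forall_path [TopologicalSpace.SeparableSpace A]
    [TopologicalSpace.SeparableSpace B] (φ : A →⋆ₙₐ[ℂ] B) (hφ : Function.Injective φ)
    (h : ∀ ε : ℝ, 0 < ε → ∀ (F : Finset A) (G : Finset B), ∃ z : ℝ → unitary 𝓜(ℂ, B),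
      StrictContinuousOn (fun t => (z t : 𝓜(ℂ, B))) (Set.Icc 0 1) ∧ z 0 = 1 ∧
      (∀ t ∈ Set.Icc (0 : ℝ) 1, ∀ a ∈ F,
        ‖(z t : 𝓜(ℂ, B)) * (φ a : 𝓜(ℂ, B)) * star (z t : 𝓜(ℂ, B)) - (φ a : 𝓜(ℂ, B))‖ ≤ ε) ∧
      ∀ b ∈ G, Metric.infDist (star (z 1 : 𝓜(ℂ, B)) * (b : 𝓜(ℂ, B)) * (z 1 : 𝓜(ℂ, B)))
        (Set.range fun a : A => (φ a : 𝓜(ℂ, B))) ≤ ε) :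
    ∃ Φ : A ≃⋆ₐ[ℂ] B, AsympUnitaryEquiv φ Φ := by
  obtain ⟨α, hα⟩ := TopologicalSpace.exists_dense_seq A
  obtain ⟨β, hβ⟩ := TopologicalSpace.exists_dense_seq B
  obtain ⟨U, z, F, hz, hU, hzc, hF, hαF, hzF, hβF⟩ := exists_intertwining_sequence φ h α β
  have hsmall {δ : ℝ} (hδ : 0 < δ) : ∀ᶠ n : ℕ in atTop, 2 * (1 / 2 : ℝ) ^ n < δ := by
    have := (tendsto_pow_atTop_nhds_zero_of_lt_one (r := (1 / 2 : ℝ)) (by norm_num)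
      (by norm_num)).const_mul 2
    rw [mul_zero] at this
    exact this.eventually_lt_const hδ
  have hest {n : ℕ} {a : A} (ha : a ∈ F n) {t : ℝ} (ht : n ≤ t) :
      ‖conjHom φ (concatPath U z t) a - conjHom φ (U n) a‖ ≤ 2 * (1 / 2) ^ n :=
    norm_concatPath_conj_sub_le hU (fun k hk t ht => hzF k t ht a (hF hk ha)) ht
  obtain ⟨Φ, hΦ⟩ := exists_starAlgEquiv_of_cauchySeq DoubleCentralizer.coeHom
    DoubleCentralizer.coeHom_injective_s6 (fun t : ℝ => conjHom φ (concatPath U z t))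
    (fun t => conjHom_injective hφ _) (fun t a => conjHom_mem_range φ _ a)
    (fun a => Metric.cauchySeq_iff'.2 fun ε hε => by
      obtain ⟨j, hj⟩ := Metric.denseRange_iff.1 hα a (ε / 4) (by positivity)
      obtain ⟨n, hn, hjn⟩ := ((hsmall (show 0 < ε / 4 by positivity)).and
        (eventually_ge_atTop (j + 1))).exists
      have hmem : α j ∈ F n := hF hjn (hαF j)
      refine ⟨n, fun t ht => ?_⟩
      have h1 := hest hmem ht
      have h2 := hest hmem (le_refl (n : ℝ))
      have hd (s : ℝ) : dist (conjHom φ (concatPath U z s) a)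
          (conjHom φ (concatPath U z s) (α j)) < ε / 4 := by
        rwa [(NonUnitalStarAlgHom.isometry _ (conjHom_injective hφ _)).dist_eq]
      have h3 := hd t
      have h4 := hd n
      rw [← dist_eq_norm] at h1 h2
      rw [dist_comm] at h2 h4
      have := dist_triangle4 (conjHom φ (concatPath U z t) a)
        (conjHom φ (concatPath U z t) (α j)) (conjHom φ (U n) (α j))
        (conjHom φ (concatPath U z n) a)
      have := dist_triangle (conjHom φ (U n) (α j)) (conjHom φ (concatPath U z n) (α j))
        (conjHom φ (concatPath U z n) a)
      linarith)
    hβ (by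
      rintro _ ⟨j, rfl⟩ ε hε
      obtain ⟨n, hn, hjn⟩ := ((hsmall (half_pos hε)).and (eventually_ge_atTop j)).exists
      obtain ⟨a, haF, ha⟩ := hβF n j hjn
      refine ⟨a, (eventually_ge_atTop ((n + 1 : ℕ) : ℝ)).mono fun t ht => ?_⟩
      refine (norm_sub_le_norm_sub_add_norm_sub _ _ _).trans ((add_le_add (hest haF ht) ha).trans ?_)
      have : (0 : ℝ) < (1 / 2) ^ n := by positivity
      rw [pow_succ]
      linarith)
  exact ⟨Φ, concatPath U z, strictContinuousOn_concatPath hz hU hzc, fun a =>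
    tendsto_iff_norm_sub_tendsto_zero.1 (hΦ a)⟩

end Intertwining

/-- An injective ⋆-homomorphism `φ : A → B` between separable C⋆-algebras is
asymptotically unitarily equivalent to a ⋆-isomorphism of `A` onto `B` if and only if for every
`ε > 0` and finite sets `F ⊆ A`, `G ⊆ B` there is a strictly continuous path
`z : [0,1] → U(𝓜(ℂ, B))` with `z 0 = 1`, almost commuting with `φ(F)` along the whole path,
and with `z 1` almost conjugating `G` into `φ(A)`. -/
theorem stmt6 {A B : Type*}
    [NonUnitalCStarAlgebra A] [NonUnitalCStarAlgebra B]
    [TopologicalSpace.SeparableSpace A] [TopologicalSpace.SeparableSpace B]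
    (φ : A →⋆ₙₐ[ℂ] B) (hinj : Function.Injective φ) :
    (∃ Φ : A ≃⋆ₐ[ℂ] B, AsympUnitaryEquiv (⇑φ) (⇑Φ)) ↔
      (∀ ε : ℝ, 0 < ε → ∀ (F : Finset A) (G : Finset B),
        ∃ z : ℝ → unitary 𝓜(ℂ, B),
          (∀ b : B,
            ContinuousOn (fun t => ((z t : 𝓜(ℂ, B)) * (b : 𝓜(ℂ, B)))) (Set.Icc (0 : ℝ) 1) ∧
            ContinuousOn (fun t => ((b : 𝓜(ℂ, B)) * (z t : 𝓜(ℂ, B)))) (Set.Icc (0 : ℝ) 1)) ∧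
          z 0 = 1 ∧
          (∀ t ∈ Set.Icc (0 : ℝ) 1, ∀ a ∈ F,
            ‖(z t : 𝓜(ℂ, B)) * (φ a : 𝓜(ℂ, B)) * star (z t : 𝓜(ℂ, B)) - (φ a : 𝓜(ℂ, B))‖ ≤ ε) ∧
          (∀ b ∈ G,
            Metric.infDist (star (z 1 : 𝓜(ℂ, B)) * (b : 𝓜(ℂ, B)) * (z 1 : 𝓜(ℂ, B)))
              (Set.range fun a : A => (φ a : 𝓜(ℂ, B))) ≤ ε)) :=
  ⟨fun ⟨Φ, hΦ⟩ _ hε F G => exists_path_of_asympUnitaryEquiv (Φ := Φ.toEquiv) hΦ hε F G,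
    fun h => exists_asympUnitaryEquiv_of_forall_path φ hinj h⟩
end

section
/- Let A be a separable C*-algebra, B a separable unital C*-algebra, and φ: A → B_∞ a *-homomorphism into the sequence algebra of B. Then the following are equivalent: (i) there exist a unitary u ∈ B_∞ and a *-homomorphism ψ: A → B such that u φ(a) u* equals the class of the constant sequence ψ(a) for every a ∈ A; (ii) for every map η: ℕ → ℕ with η(n) → ∞, the *-homomorphisms φ and η* ∘ φ are approximately unitarily equivalent. -/
open Filter Topology BoundedContinuousFunction

/-- Approximate unitary equivalence of maps into a unital C⋆-algebra `Q`:
there is a sequence of unitaries `u k ∈ U(Q)` with `‖u k * φ a * (u k)⋆ - ψ a‖ → 0`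
for every `a`. -/
def ApproxUnitaryEquivUnital {A Q : Type*} [NonUnitalCStarAlgebra A] [CStarAlgebra Q]
    (φ ψ : A → Q) : Prop :=
  ∃ u : ℕ → unitary Q, ∀ a : A,
    Tendsto (fun k => ‖(u k : Q) * φ a * star (u k : Q) - ψ a‖) atTop (𝓝 (0 : ℝ))

section UnitaryPerturbation

variable {B : Type*} [CStarAlgebra B]

/-- An approximately unitary element of a unital C⋆-algebra is close to a unitary. -/
lemma exists_unitary_norm_sub_le (x : B) (h₁ : ‖star x * x - 1‖ < 1)
    (h₂ : ‖x * star x - 1‖ < 1) :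
    ∃ v : unitary B, ‖(v : B) - x‖ ≤ ‖star x * x - 1‖ := by
  set h : B := star x * x with hh
  have hsa : IsSelfAdjoint h := IsSelfAdjoint.star_mul_self x
  have hspec : ∀ t ∈ spectrum ℝ h, |t - 1| ≤ ‖h - 1‖ := by
    intro t ht
    have key : cfc (fun t : ℝ => t - 1) h = h - 1 := by
      rw [cfc_sub (fun t : ℝ => t) (fun _ => 1) h, cfc_id' ℝ h, cfc_const_one ℝ h]
    rw [← key]
    exact norm_apply_le_norm_cfc (fun t : ℝ => t - 1) h ht
  have hpos : ∀ t ∈ spectrum ℝ h, 0 < t := fun t ht => by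
    have := abs_lt.1 ((hspec t ht).trans_lt h₁)
    linarith [this.1]
  set g : ℝ → ℝ := fun t => (√t)⁻¹ with hg
  have hgc : ContinuousOn g (spectrum ℝ h) :=
    Real.continuous_sqrt.continuousOn.inv₀ fun t ht => (Real.sqrt_pos.2 (hpos t ht)).ne'
  set r : B := cfc g h with hr
  have hrsa : star r = r := (cfc_predicate g h : IsSelfAdjoint r)
  have hrhr : r * h * r = 1 := by
    calc r * h * r = cfc g h * cfc (fun t : ℝ => t) h * cfc g h := by rw [cfc_id' ℝ h]
      _ = cfc (fun t => g t * t * g t) h := by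
        rw [cfc_mul (fun t => g t * t) g h (hgc.mul continuousOn_id) hgc,
          cfc_mul g (fun t => t) h hgc continuousOn_id]
      _ = cfc (fun _ : ℝ => (1 : ℝ)) h := by
        refine cfc_congr fun t ht => ?_
        have h0 := Real.sqrt_pos.2 (hpos t ht)
        have h1 := Real.mul_self_sqrt (hpos t ht).le
        simp only [hg]
        field_simp
        nlinarith
      _ = 1 := cfc_const_one ℝ h
  have hcomm : Commute h r := by
    have := cfc_commute_cfc (fun t : ℝ => t) g h
    rwa [cfc_id' ℝ h] at this
  have hhrr : h * (r * r) = 1 := by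
    rw [← mul_assoc, hcomm.eq, hrhr]
  have hunit : IsUnit (x * star x) := by
    have : ‖1 - x * star x‖ < 1 := by rwa [norm_sub_rev]
    have := (Units.oneSub _ this).isUnit
    simpa using this
  have hv : x * r ∈ unitary B := by
    refine Unitary.mem_iff.2 ⟨?_, ?_⟩
    · rw [star_mul, hrsa, ← hrhr, hh]
      noncomm_ring
    · rw [star_mul, hrsa]
      refine hunit.mul_left_cancel ?_
      calc x * star x * (x * r * (r * star x)) = x * (star x * x * (r * r)) * star x := by
            noncomm_ring
        _ = x * star x * 1 := by rw [← hh, hhrr]; simp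
  refine ⟨⟨x * r, hv⟩, ?_⟩
  have hsq : star (x * r - x) * (x * r - x) = cfc (fun t : ℝ => (g t - 1) * t * (g t - 1)) h := by
    have hr1 : cfc (fun t => g t - 1) h = r - 1 := by
      rw [cfc_sub g (fun _ => 1) h hgc, cfc_const_one ℝ h]
    have hgc1 : ContinuousOn (fun t => g t - 1) (spectrum ℝ h) := hgc.sub continuousOn_const
    rw [cfc_mul (fun t => (g t - 1) * t) (fun t => g t - 1) h (hgc1.mul continuousOn_id) hgc1,
      cfc_mul (fun t => g t - 1) (fun t => t) h hgc1 continuousOn_id, cfc_id' ℝ h, hr1,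
      star_sub, star_mul, hrsa, hh]
    noncomm_ring
  refine le_of_sq_le_sq ?_ (norm_nonneg _)
  rw [sq, ← CStarRing.norm_star_mul_self, hsq]
  refine norm_cfc_le (by positivity) fun t ht => ?_
  have h0 := Real.sqrt_pos.2 (hpos t ht)
  have h1 := Real.mul_self_sqrt (hpos t ht).le
  have h2 : (g t - 1) * t * (g t - 1) = (√t - 1) ^ 2 := by
    simp only [hg]
    conv_lhs => rw [← h1]
    rw [Real.sqrt_mul_self h0.le]
    field_simp
    ring
  have h3 : (√t - 1) ^ 2 ≤ (t - 1) ^ 2 := by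
    have : t - 1 = (√t - 1) * (√t + 1) := by linarith
    rw [this, mul_pow]
    nlinarith [sq_nonneg (√t - 1)]
  rw [h2, Real.norm_of_nonneg (sq_nonneg _)]
  exact h3.trans (sq_le_sq' (by linarith [(abs_le.1 (hspec t ht)).1]) (abs_le.1 (hspec t ht)).2)

lemma norm_unitary_conj_sub (v : unitary B) (a b : B) :
    ‖(v : B) * a * star (v : B) - v * b * star (v : B)‖ = ‖a - b‖ := by
  have : (v : B) * a * star (v : B) - v * b * star (v : B)
      = v * (a - b) * ((star v : unitary B) : B) := by
    rw [Unitary.coe_star]; noncomm_ring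
  rw [this, CStarRing.norm_mul_coe_unitary, CStarRing.norm_coe_unitary_mul]

lemma norm_unitary_conj_sub_comm (v : unitary B) (a b : B) :
    ‖(v : B) * a * star (v : B) - b‖ = ‖((star v : unitary B) : B) * b *
      star ((star v : unitary B) : B) - a‖ := by
  have : b = (v : B) * (star (v : B) * b * v) * star (v : B) := by
    rw [show (v : B) * (star (v : B) * b * v) * star (v : B)
      = (v * star (v : B)) * b * (v * star (v : B)) by noncomm_ring]
    simp
  conv_lhs => rw [this]
  rw [norm_unitary_conj_sub, norm_sub_rev]
  simp

/-- Sequences that are pairwise approximately unitarily conjugate with respect to more and more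
indices can be unitarily conjugated, simultaneously, to convergent sequences. -/
lemma exists_unitary_conj_tendsto (x : ℕ → ℕ → B)
    (hx : ∀ m : ℕ, ∀ ε > (0 : ℝ), ∀ᶠ k in atTop, ∀ n ≥ k, ∃ v : unitary B, ∀ i < m,
      ‖(v : B) * x i n * star (v : B) - x i k‖ < ε) :
    ∃ (w : ℕ → unitary B) (y : ℕ → B), ∀ i,
      Tendsto (fun n => (w n : B) * x i n * star (w n : B)) atTop (𝓝 (y i)) := by
  obtain ⟨k, hk, hP⟩ := extraction_forall_of_eventually
    (fun j : ℕ => hx j ((1 / 2 : ℝ) ^ j) (by positivity))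
  choose! U hU using hP
  obtain ⟨V, hV⟩ : ∃ V : ℕ → unitary B, ∀ j, V (j + 1) = V j * U j (k (j + 1)) :=
    ⟨fun j => Nat.rec 1 (fun j v => v * U j (k (j + 1))) j, fun _ => rfl⟩
  have hconj : ∀ (j n i : ℕ), k j ≤ n → i < j →
      ‖((V j * U j n : unitary B) : B) * x i n * star ((V j * U j n : unitary B) : B)
        - (V j : B) * x i (k j) * star (V j : B)‖ < (1 / 2 : ℝ) ^ j := by
    intro j n i hn hi
    have : ((V j * U j n : unitary B) : B) * x i n * star ((V j * U j n : unitary B) : B)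
        = (V j : B) * ((U j n : B) * x i n * star (U j n : B)) * star (V j : B) := by
      rw [Submonoid.coe_mul, star_mul]; noncomm_ring
    rw [this, norm_unitary_conj_sub]
    exact hU j n hn i hi
  let z : ℕ → ℕ → B := fun i j => (V j : B) * x i (k j) * star (V j : B)
  have hz : ∀ i, ∃ y, Tendsto (z i) atTop (𝓝 y) := by
    intro i
    have hc : CauchySeq fun j => z i (j + (i + 1)) := by
      refine cauchySeq_of_le_geometric (1 / 2 : ℝ) 1 (by norm_num) fun j => ?_
      rw [dist_comm, dist_eq_norm, show j + 1 + (i + 1) = (j + (i + 1)) + 1 by ring]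
      simp only [z, hV]
      refine (hconj (j + (i + 1)) _ i (hk.monotone (Nat.le_succ _)) (by omega)).le.trans ?_
      rw [one_mul]
      exact pow_le_pow_of_le_one (by norm_num) (by norm_num) (Nat.le_add_right _ _)
    obtain ⟨y, hy⟩ := cauchySeq_tendsto_of_complete hc
    exact ⟨y, (tendsto_add_atTop_iff_nat (i + 1)).1 hy⟩
  choose y hy using hz
  let J : ℕ → ℕ := fun n => Nat.findGreatest (fun j => k j ≤ n) n
  have hJ : Tendsto J atTop atTop := by
    refine tendsto_atTop.2 fun j => ?_
    filter_upwards [eventually_ge_atTop (k j)] with n hn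
    exact Nat.le_findGreatest ((hk.id_le j).trans hn) hn
  refine ⟨fun n => V (J n) * U (J n) n, y, fun i => ?_⟩
  refine ((hy i).comp hJ).congr_dist ?_
  have hsmall : Tendsto (fun n => (1 / 2 : ℝ) ^ J n) atTop (𝓝 0) :=
    (tendsto_pow_atTop_nhds_zero_of_lt_one (by norm_num) (by norm_num)).comp hJ
  refine squeeze_zero' (Eventually.of_forall fun _ => dist_nonneg) ?_ hsmall
  filter_upwards [hJ.eventually_gt_atTop i, eventually_ge_atTop (k 0)] with n hi hn
  rw [dist_comm, dist_eq_norm]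
  exact (hconj (J n) n i (Nat.findGreatest_spec (P := fun j => k j ≤ n) (Nat.zero_le n) hn) hi).le

end UnitaryPerturbation

/-- A ⋆-homomorphism that maps a dense set into the range of an injective ⋆-homomorphism
factors through it. -/
lemma exists_factor_of_denseRange {A B Q : Type*} [NonUnitalCStarAlgebra A]
    [NonUnitalCStarAlgebra B] [NonUnitalCStarAlgebra Q] (f : A →⋆ₙₐ[ℂ] Q) (ι : B →⋆ₙₐ[ℂ] Q)
    (hι : Function.Injective ι) {a : ℕ → A} (ha : DenseRange a)
    (h : ∀ i, f (a i) ∈ Set.range ι) :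
    ∃ ψ : A →⋆ₙₐ[ℂ] B, ∀ x, f x = ι (ψ x) := by
  have hclosed : IsClosed (Set.range ι) :=
    (NonUnitalStarAlgHom.isometry ι hι).isClosedEmbedding.isClosed_range
  have hf : Continuous f :=
    AddMonoidHomClass.continuous_of_bound f 1 fun x => by
      simpa using NonUnitalStarAlgHom.norm_apply_le f x
  have hall : ∀ x, ∃ b, ι b = f x := fun x =>
    ha.induction_on (p := fun x => f x ∈ Set.range ι) x (hclosed.preimage hf) h
  choose ψ hψ using hall
  refine ⟨{ toFun := ψ
            map_smul' := fun c x => hι ?_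
            map_zero' := hι ?_
            map_add' := fun x y => hι ?_
            map_mul' := fun x y => hι ?_
            map_star' := fun x => hι ?_ }, fun x => (hψ x).symm⟩ <;>
  simp [hψ, map_smul, map_star]

section SequenceAlgebra

variable {B Q : Type*} [CStarAlgebra B] [CStarAlgebra Q]

/-- The bounded sequence given by a sequence of unitaries. -/
noncomputable def unitarySeq (v : ℕ → unitary B) : ℕ →ᵇ B :=
  BoundedContinuousFunction.ofNormedAddCommGroup (fun n => (v n : B))
    continuous_of_discreteTopology 1 fun n => by
      rcases subsingleton_or_nontrivial B with hB | hB
      · simp [Subsingleton.elim (v n : B) 0]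
      · exact (CStarRing.norm_coe_unitary (v n)).le

@[simp]
lemma unitarySeq_apply (v : ℕ → unitary B) (n : ℕ) : unitarySeq v n = v n := rfl

lemma unitarySeq_mem_unitary (v : ℕ → unitary B) : unitarySeq v ∈ unitary (ℕ →ᵇ B) := by
  refine Unitary.mem_iff.2 ⟨?_, ?_⟩ <;> ext n <;> simp

lemma map_eq_map_iff_tendsto (π : (ℕ →ᵇ B) →⋆ₐ[ℂ] Q)
    (hker : ∀ f : ℕ →ᵇ B, π f = 0 ↔ Tendsto (fun n => ‖f n‖) atTop (𝓝 (0 : ℝ)))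
    (f g : ℕ →ᵇ B) :
    π f = π g ↔ Tendsto (fun n => ‖f n - g n‖) atTop (𝓝 (0 : ℝ)) := by
  rw [← sub_eq_zero, ← map_sub, hker]
  rfl

lemma exists_forall_norm_map_lt (π : (ℕ →ᵇ B) →⋆ₐ[ℂ] Q) (hsurj : Function.Surjective π)
    (hker : ∀ f : ℕ →ᵇ B, π f = 0 ↔ Tendsto (fun n => ‖f n‖) atTop (𝓝 (0 : ℝ)))
    {ε : ℝ} (hε : 0 < ε) :
    ∃ δ > 0, ∀ f : ℕ →ᵇ B, ‖π f‖ < δ → ∀ᶠ n in atTop, ‖f n‖ < ε := by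
  let L : (ℕ →ᵇ B) →L[ℂ] Q := ⟨(π : (ℕ →ᵇ B) →ₐ[ℂ] Q).toLinearMap,
    AddMonoidHomClass.continuous_of_bound π 1 fun x => by
      simpa using NonUnitalStarAlgHom.norm_apply_le π x⟩
  obtain ⟨C, hC, hL⟩ := L.exists_preimage_norm_le hsurj
  refine ⟨ε / 2 / C, by positivity, fun f hf => ?_⟩
  obtain ⟨g, hg, hgn⟩ := hL (π f)
  have hg' : π f = π g := hg.symm
  have hlt : ‖g‖ < ε / 2 := hgn.trans_lt (by rwa [lt_div_iff₀' hC] at hf)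
  have := (map_eq_map_iff_tendsto π hker f g).1 hg'
  filter_upwards [this.eventually_lt_const (half_pos hε)] with n hn
  calc ‖f n‖ = ‖(f n - g n) + g n‖ := by simp
    _ ≤ ‖f n - g n‖ + ‖g n‖ := norm_add_le _ _
    _ < ε := by linarith [g.norm_coe_le_norm n]

/-- Unitaries of the sequence algebra lift to sequences of unitaries. -/
lemma exists_unitarySeq_lift (π : (ℕ →ᵇ B) →⋆ₐ[ℂ] Q) (hsurj : Function.Surjective π)
    (hker : ∀ f : ℕ →ᵇ B, π f = 0 ↔ Tendsto (fun n => ‖f n‖) atTop (𝓝 (0 : ℝ)))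
    (u : unitary Q) : ∃ v : ℕ → unitary B, π (unitarySeq v) = u := by
  obtain ⟨x, hx⟩ := hsurj u
  have h₁ : Tendsto (fun n => ‖star (x n) * x n - 1‖) atTop (𝓝 0) := by
    have : π (star x * x) = π 1 := by simp [map_star, hx]
    simpa using (map_eq_map_iff_tendsto π hker _ _).1 this
  have h₂ : Tendsto (fun n => ‖x n * star (x n) - 1‖) atTop (𝓝 0) := by
    have : π (x * star x) = π 1 := by simp [map_star, hx]
    simpa using (map_eq_map_iff_tendsto π hker _ _).1 this
  have hv : ∀ n, ∃ v : unitary B, ‖star (x n) * x n - 1‖ < 1 → ‖x n * star (x n) - 1‖ < 1 →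
      ‖(v : B) - x n‖ ≤ ‖star (x n) * x n - 1‖ := by
    intro n
    by_cases hn : ‖star (x n) * x n - 1‖ < 1 ∧ ‖x n * star (x n) - 1‖ < 1
    · obtain ⟨v, hv⟩ := exists_unitary_norm_sub_le (x n) hn.1 hn.2
      exact ⟨v, fun _ _ => hv⟩
    · exact ⟨1, fun h h' => absurd ⟨h, h'⟩ hn⟩
  choose v hv using hv
  refine ⟨v, ?_⟩
  rw [← hx, map_eq_map_iff_tendsto π hker]
  refine squeeze_zero' (Eventually.of_forall fun _ => norm_nonneg _) ?_ h₁
  filter_upwards [h₁.eventually_lt_const one_pos, h₂.eventually_lt_const one_pos] with n hn₁ hn₂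
  exact hv n hn₁ hn₂

/-- A reparametrisation tending to infinity induces an endomorphism of the sequence algebra. -/
lemma exists_reparametrization (π : (ℕ →ᵇ B) →⋆ₐ[ℂ] Q) (hsurj : Function.Surjective π)
    (hker : ∀ f : ℕ →ᵇ B, π f = 0 ↔ Tendsto (fun n => ‖f n‖) atTop (𝓝 (0 : ℝ)))
    (η : ℕ → ℕ) (hη : Tendsto η atTop atTop) :
    ∃ σ : Q →⋆ₐ[ℂ] Q, ∀ f : ℕ →ᵇ B,
      σ (π f) = π (f.compContinuous ⟨η, continuous_of_discreteTopology⟩) := by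
  let c : (ℕ →ᵇ B) → (ℕ →ᵇ B) := fun f => f.compContinuous ⟨η, continuous_of_discreteTopology⟩
  choose s hs using hsurj
  have hc : ∀ f g, π f = π g → π (c f) = π (c g) := fun f g h =>
    (map_eq_map_iff_tendsto π hker _ _).2 (((map_eq_map_iff_tendsto π hker f g).1 h).comp hη)
  refine ⟨{ toFun := fun q => π (c (s q))
            map_one' := ?_
            map_mul' := fun p q => ?_
            map_zero' := ?_
            map_add' := fun p q => ?_
            commutes' := fun r => ?_
            map_star' := fun q => ?_ }, fun f => hc _ _ (hs _)⟩
  · rw [hc (s 1) 1 (by simp [hs]), show c 1 = 1 from rfl, map_one]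
  · rw [hc (s (p * q)) (s p * s q) (by simp [hs]), ← map_mul]; rfl
  · rw [hc (s 0) 0 (by simp [hs]), show c 0 = 0 from rfl, map_zero]
  · rw [hc (s (p + q)) (s p + s q) (by simp [hs]), ← map_add]; rfl
  · rw [hc _ (algebraMap ℂ _ r) (by rw [hs]; exact (AlgHomClass.commutes π r).symm)]
    exact AlgHomClass.commutes π r
  · rw [hc (s (star q)) (star (s q)) (by simp [hs, map_star]), ← map_star]; rfl

end SequenceAlgebra

/-- (Intertwining through reparametrisation.) Let `Q = B_∞` be the sequence
algebra of a separable unital C⋆-algebra `B`, presented as a quotient of `ℓ∞(ℕ, B) = ℕ →ᵇ B` by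
the ideal of null sequences via a surjective ⋆-homomorphism `π` whose kernel consists exactly of
the null sequences.  A ⋆-homomorphism `φ : A → B_∞` is unitarily conjugate to one taking values
in the constant sequences if and only if for every reparametrisation `η : ℕ → ℕ` with
`η n → ∞`, the maps `φ` and `η⋆ ∘ φ` are approximately unitarily equivalent, where
`η⋆ : B_∞ → B_∞` is the endomorphism induced by `η`. -/
theorem stmt8 {A B Q : Type*}
    [NonUnitalCStarAlgebra A] [TopologicalSpace.SeparableSpace A]
    [CStarAlgebra B] [TopologicalSpace.SeparableSpace B] [CStarAlgebra Q]
    (π : (ℕ →ᵇ B) →⋆ₐ[ℂ] Q) (hsurj : Function.Surjective π)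
    (hker : ∀ f : ℕ →ᵇ B, π f = 0 ↔ Tendsto (fun n => ‖f n‖) atTop (𝓝 (0 : ℝ)))
    (φ : A →⋆ₙₐ[ℂ] Q) :
    (∃ (u : unitary Q) (ψ : A →⋆ₙₐ[ℂ] B), ∀ a : A,
        (u : Q) * φ a * star (u : Q) = π (BoundedContinuousFunction.const ℕ (ψ a))) ↔
      (∀ η : ℕ → ℕ, Tendsto η atTop atTop →
        ∀ σ : Q →⋆ₐ[ℂ] Q,
          (∀ f : ℕ →ᵇ B,
            σ (π f) = π (f.compContinuous ⟨η, continuous_of_discreteTopology⟩)) →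
          ApproxUnitaryEquivUnital (⇑φ) (fun a => σ (φ a))) := by
  constructor
  · rintro ⟨u, ψ, hψ⟩ η _ σ hσ
    have hfix : ∀ a, σ ((u : Q) * φ a * star (u : Q)) = (u : Q) * φ a * star (u : Q) := by
      intro a
      rw [hψ, hσ]
      rfl
    have huu : star (σ (u : Q)) * σ u = 1 := by rw [← map_star, ← map_mul]; simp
    have hσu : star (σ (u : Q)) * u ∈ unitary Q :=
      mul_mem (Unitary.star_mem (Unitary.map_mem σ u.2)) u.2
    refine ⟨fun _ => ⟨_, hσu⟩, fun a => ?_⟩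
    have : star (σ (u : Q)) * u * φ a * star (star (σ (u : Q)) * (u : Q)) = σ (φ a) := by
      calc star (σ (u : Q)) * u * φ a * star (star (σ (u : Q)) * (u : Q))
          = star (σ (u : Q)) * (u * φ a * star (u : Q)) * σ u := by
            rw [star_mul, star_star]; noncomm_ring
        _ = (star (σ (u : Q)) * σ u) * σ (φ a) * (star (σ (u : Q)) * σ u) := by
            rw [← hfix, map_mul, map_mul, map_star]; noncomm_ring
        _ = σ (φ a) := by rw [huu]; simp
    simp only [this, sub_self, norm_zero, tendsto_const_nhds_iff]
  · intro H
    have hdense := TopologicalSpace.denseRange_denseSeq A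
    set a := TopologicalSpace.denseSeq A
    choose F hF using fun i => hsurj (φ (a i))
    have claim : ∀ m : ℕ, ∀ ε > (0 : ℝ), ∀ᶠ k in atTop, ∀ n ≥ k, ∃ v : unitary B, ∀ i < m,
        ‖(v : B) * F i n * star (v : B) - F i k‖ < ε := by
      intro m ε hε
      by_contra hcon
      let bad : ℕ → ℕ → Prop := fun k n => n ≥ k ∧ ∀ v : unitary B, ∃ i < m,
        ε ≤ ‖(v : B) * F i n * star (v : B) - F i k‖
      have hη : ∀ k, ∃ n, n ≥ k ∧ ((∃ n, bad k n) → bad k n) := by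
        intro k
        by_cases hk : ∃ n, bad k n
        · exact ⟨hk.choose, hk.choose_spec.1, fun h => h.choose_spec⟩
        · exact ⟨k, le_rfl, fun h => absurd h hk⟩
      choose η hηk hηbad using hη
      have hηtop : Tendsto η atTop atTop := tendsto_atTop_mono hηk tendsto_id
      obtain ⟨σ, hσ⟩ := exists_reparametrization π hsurj hker η hηtop
      obtain ⟨u, hu⟩ := H η hηtop σ hσ
      obtain ⟨δ, hδ, hδε⟩ := exists_forall_norm_map_lt π hsurj hker hε
      have hfin : ∀ᶠ j in atTop, ∀ i < m,
          ‖(u j : Q) * φ (a i) * star (u j : Q) - σ (φ (a i))‖ < δ :=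
        (Set.finite_lt_nat m).eventually_all.2 fun i _ =>
          (hu (a i)).eventually_lt_const hδ
      obtain ⟨j, hj⟩ := hfin.exists
      obtain ⟨v, hv⟩ := exists_unitarySeq_lift π hsurj hker (u j)
      have hev : ∀ᶠ k in atTop, ∀ i < m,
          ‖(v k : B) * F i k * star (v k : B) - F i (η k)‖ < ε := by
        refine (Set.finite_lt_nat m).eventually_all.2 fun i hi => ?_
        refine hδε (unitarySeq v * F i * star (unitarySeq v) -
          (F i).compContinuous ⟨η, continuous_of_discreteTopology⟩) ?_
        rw [map_sub, ← hσ, map_mul, map_mul, map_star, hv, hF]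
        exact hj i hi
      apply hcon
      filter_upwards [hev] with k hk n hn
      by_contra! hno
      obtain ⟨i, hi, hle⟩ := (hηbad k ⟨n, hn, hno⟩).2 (star (v k))
      rw [← norm_unitary_conj_sub_comm] at hle
      exact absurd (hk i hi) hle.not_gt
    obtain ⟨w, y, hy⟩ := exists_unitary_conj_tendsto (fun i n => F i n) claim
    have hu : π (unitarySeq w) ∈ unitary Q := Unitary.map_mem π (unitarySeq_mem_unitary w)
    let ι : B →⋆ₙₐ[ℂ] Q :=
      { toFun := fun b => π (BoundedContinuousFunction.const ℕ b)
        map_smul' := fun c b => map_smul π c (BoundedContinuousFunction.const ℕ b)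
        map_zero' := map_zero π
        map_add' := fun b c => map_add π (.const ℕ b) (.const ℕ c)
        map_mul' := fun b c => map_mul π (.const ℕ b) (.const ℕ c)
        map_star' := fun b => map_star π (.const ℕ b) }
    have hι : Function.Injective ι := by
      refine (injective_iff_map_eq_zero ι).2 fun b hb => ?_
      have h0 := (hker (.const ℕ b)).1 hb
      exact norm_eq_zero.1 (tendsto_nhds_unique tendsto_const_nhds h0)
    let f : A →⋆ₙₐ[ℂ] Q :=
      ((Unitary.conjStarAlgAut ℂ Q ⟨_, hu⟩ : Q ≃⋆ₐ[ℂ] Q) : Q →⋆ₙₐ[ℂ] Q).comp φ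
    have hf : ∀ x, f x = π (unitarySeq w) * φ x * star (π (unitarySeq w)) := fun x => rfl
    obtain ⟨ψ, hψ⟩ := exists_factor_of_denseRange f ι hι hdense fun i => by
      refine ⟨y i, ?_⟩
      rw [hf, ← hF, ← map_star, ← map_mul, ← map_mul]
      refine Eq.symm ((map_eq_map_iff_tendsto π hker _ _).2 ?_)
      exact tendsto_iff_norm_sub_tendsto_zero.1 (hy i)
    exact ⟨⟨_, hu⟩, ψ, fun x => (hf x).symm.trans (hψ x)⟩
end
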